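/- Let Ω ⊂ ℂ^N be a domain and let p ∈ ∂Ω be a C²-smooth boundary point. The following conditions are equivalent: (1) Ω is strongly convex at p (the restriction of the Hessian of the signed distance ~δ_Ω at p to the real tangent space T_p(∂Ω) is strictly positive definite); (2) liminf_{Ω∋z,w→p} h^ℝ_Ω(z,w)/‖z−w‖² > 0; (3) liminf_{Ω∋w→p} ‖(p−w)_p^ℝ‖/‖p−w‖² > 0, where (p−w)_p^ℝ := Re⟨p−w, η_p⟩·η_p and η_p is the outer unit normal to ∂Ω at p. -/

import Mathlib

open Metric Set Filter Topology MeasureTheory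

noncomputable section

namespace InvDist

/-- Complex Euclidean `N`-space. -/
abbrev E (N : ℕ) := EuclideanSpace ℂ (Fin N)

variable {N : ℕ}

/-- The paper's Hermitian product `⟨a,b⟩ = ∑ a_j * conj (b_j)`. -/
def herm (a b : E N) : ℂ := ∑ j, a j * (starRingEnd ℂ) (b j)

/-- Euclidean distance to the boundary of `Ω`. -/
def bdist (Ω : Set (E N)) (x : E N) : ℝ := Metric.infDist x (frontier Ω)

/-- `π` selects, for each point of `Ω`, a closest point on the boundary. -/
def IsClosestPointSelection (Ω : Set (E N)) (π : E N → E N) : Prop :=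
  ∀ z ∈ Ω, π z ∈ frontier Ω ∧ dist z (π z) = bdist Ω z

/-- `‖v_z‖`: modulus of the complex normal component of `v` with respect to the
closest boundary point `π z`; the outer unit normal at `π z` is `(π z - z)/‖π z - z‖`. -/
def ncomp (Ω : Set (E N)) (π : E N → E N) (z v : E N) : ℝ :=
  ‖herm v (π z - z)‖ / bdist Ω z

/-- `‖v_z^ℝ‖`: modulus of the real normal component of `v` at `π z`. -/
def ncompR (Ω : Set (E N)) (π : E N → E N) (z v : E N) : ℝ :=
  |(herm v (π z - z)).re| / bdist Ω z

/-- The quantity `A_Ω(z,w)`. -/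
def Afun (Ω : Set (E N)) (π : E N → E N) (z w : E N) : ℝ :=
  (ncomp Ω π z (z - w) + ‖z - w‖ ^ 2 + ‖z - w‖ * Real.sqrt (bdist Ω z)) /
    (Real.sqrt (bdist Ω z) * Real.sqrt (bdist Ω w))

/-- `h_Ω(z,w) = ‖(z-w)_z‖ + ‖z-w‖ δ_Ω(z)^{1/2}`. -/
def hfun (Ω : Set (E N)) (π : E N → E N) (z w : E N) : ℝ :=
  ncomp Ω π z (z - w) + ‖z - w‖ * Real.sqrt (bdist Ω z)

/-- real analogue of `h_Ω`. -/
def hfunR (Ω : Set (E N)) (π : E N → E N) (z w : E N) : ℝ :=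
  ncompR Ω π z (z - w) + ‖z - w‖ * Real.sqrt (bdist Ω z)

/-- inverse hyperbolic tangent -/
def artanh (x : ℝ) : ℝ := Real.log ((1 + x) / (1 - x)) / 2

/-- The Lempert function of `Ω`. -/
def lempert (Ω : Set (E N)) (z w : E N) : ℝ :=
  artanh (sInf { r : ℝ | ∃ φ : ℂ → E N, DifferentiableOn ℂ φ (ball 0 1) ∧
    MapsTo φ (ball (0:ℂ) 1) Ω ∧ φ 0 = z ∧ ∃ a ∈ ball (0:ℂ) 1, φ a = w ∧ r = ‖a‖ })

/-- The Carathéodory distance of `Ω`. -/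
def caratheodory (Ω : Set (E N)) (z w : E N) : ℝ :=
  artanh (sSup { r : ℝ | ∃ f : E N → ℂ, DifferentiableOn ℂ f Ω ∧
    MapsTo f Ω (ball (0:ℂ) 1) ∧ f z = 0 ∧ r = ‖f w‖ })

/-- The Kobayashi distance: the largest pseudodistance not exceeding the Lempert
function, given as an infimum over chains. -/
def kobayashi (Ω : Set (E N)) (z w : E N) : ℝ :=
  sInf { r : ℝ | ∃ (n : ℕ) (p : Fin (n + 1) → E N), p 0 = z ∧ p (Fin.last n) = w ∧
    (∀ i, p i ∈ Ω) ∧ r = ∑ i : Fin n, lempert Ω (p i.castSucc) (p i.succ) }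

/-- The Poincaré distance on the unit disc. -/
def poincare (ζ ξ : ℂ) : ℝ := artanh ‖(ζ - ξ) / (1 - (starRingEnd ℂ) ζ * ξ)‖

/-- A complex geodesic of `Ω`. -/
def IsComplexGeodesic (Ω : Set (E N)) (φ : ℂ → E N) : Prop :=
  DifferentiableOn ℂ φ (ball 0 1) ∧ MapsTo φ (ball (0:ℂ) 1) Ω ∧
    ∀ ζ ∈ ball (0:ℂ) 1, ∀ ξ ∈ ball (0:ℂ) 1, kobayashi Ω (φ ζ) (φ ξ) = poincare ζ ξ

/-- `ρ` is `C^k` on `U` with `α`-Hölder `k`-th derivative. -/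
def IsCkHolderOn (k : ℕ) (α : ℝ) (ρ : E N → ℝ) (U : Set (E N)) : Prop :=
  ContDiffOn ℝ k ρ U ∧ ∃ M : ℝ, ∀ x ∈ U, ∀ y ∈ U,
    ‖iteratedFDeriv ℝ k ρ x - iteratedFDeriv ℝ k ρ y‖ ≤ M * ‖x - y‖ ^ α

/-- The Levi form of `ρ` at `p` evaluated at `v`. -/
def levi (ρ : E N → ℝ) (p v : E N) : ℝ :=
  (iteratedFDeriv ℝ 2 ρ p ![v, v] +
    iteratedFDeriv ℝ 2 ρ p ![(Complex.I : ℂ) • v, (Complex.I : ℂ) • v]) / 4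

/-- Bounded strongly pseudoconvex domain with `C^{k,α}`-smooth boundary. -/
def IsStronglyPseudoconvexDomain (k : ℕ) (α : ℝ) (Ω : Set (E N)) : Prop :=
  IsOpen Ω ∧ IsConnected Ω ∧ Bornology.IsBounded Ω ∧
  ∃ (U : Set (E N)) (ρ : E N → ℝ), IsOpen U ∧ closure Ω ⊆ U ∧
    IsCkHolderOn k α ρ U ∧ Ω = {x ∈ U | ρ x < 0} ∧
    (∀ p ∈ frontier Ω, fderiv ℝ ρ p ≠ 0) ∧
    ∀ p ∈ frontier Ω, ∀ v : E N, v ≠ 0 → fderiv ℝ ρ p v = 0 →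
      fderiv ℝ ρ p ((Complex.I : ℂ) • v) = 0 → 0 < levi ρ p v

/-- `η` is the outer unit normal of `Ω` at the boundary point `p`. -/
def IsOuterUnitNormalAt (Ω : Set (E N)) (p η : E N) : Prop :=
  ‖η‖ = 1 ∧ p ∈ frontier Ω ∧ ∃ ε > 0, ∀ t : ℝ, 0 < t → t < ε →
    p - t • η ∈ Ω ∧ bdist Ω (p - t • η) = t

open Classical in
/-- signed boundary distance -/
def signedDist (Ω : Set (E N)) (x : E N) : ℝ :=
  if x ∈ closure Ω then -(bdist Ω x) else bdist Ω x

/-- Hessian quadratic form of the signed boundary distance. -/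
def hessSD (Ω : Set (E N)) (p v : E N) : ℝ :=
  iteratedFDeriv ℝ 2 (signedDist Ω) p ![v, v]

/-- strict linear convexity at `p` (with outer unit normal `η`). -/
def StrictlyLinearlyConvexAt (Ω : Set (E N)) (p η : E N) : Prop :=
  ∀ v : E N, v ≠ 0 → herm v η = 0 → 0 < hessSD Ω p v

/-- strong convexity at `p` (with outer unit normal `η`). -/
def StronglyConvexAt (Ω : Set (E N)) (p η : E N) : Prop :=
  ∀ v : E N, v ≠ 0 → (herm v η).re = 0 → 0 < hessSD Ω p v

/-- `p` is a `C^k`-smooth boundary point of `Ω`. -/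
def IsCkBoundaryPoint (k : ℕ) (Ω : Set (E N)) (p : E N) : Prop :=
  p ∈ frontier Ω ∧ ∃ (U : Set (E N)) (ρ : E N → ℝ), IsOpen U ∧ p ∈ U ∧
    ContDiffOn ℝ k ρ U ∧ (∀ x ∈ U, (x ∈ Ω ↔ ρ x < 0)) ∧
    ∀ x ∈ U ∩ frontier Ω, fderiv ℝ ρ x ≠ 0

/-- bounded domain with `C^k`-smooth boundary. -/
def IsCkDomain (k : ℕ) (Ω : Set (E N)) : Prop :=
  IsOpen Ω ∧ IsConnected Ω ∧ Bornology.IsBounded Ω ∧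
    ∀ p ∈ frontier Ω, IsCkBoundaryPoint k Ω p

/-- bounded domain with `C^{1,1}`-smooth boundary. -/
def IsC11Domain (Ω : Set (E N)) : Prop :=
  IsOpen Ω ∧ IsConnected Ω ∧ Bornology.IsBounded Ω ∧
  ∀ p ∈ frontier Ω, ∃ (U : Set (E N)) (ρ : E N → ℝ), IsOpen U ∧ p ∈ U ∧
    IsCkHolderOn 1 1 ρ U ∧ (∀ x ∈ U, (x ∈ Ω ↔ ρ x < 0)) ∧
    ∀ x ∈ U ∩ frontier Ω, fderiv ℝ ρ x ≠ 0

/-- `p` is a `C^{2,α}`-smooth strongly pseudoconvex boundary point of `Ω`. -/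
def IsSPSCBoundaryPoint (α : ℝ) (Ω : Set (E N)) (p : E N) : Prop :=
  p ∈ frontier Ω ∧ ∃ (U : Set (E N)) (ρ : E N → ℝ), IsOpen U ∧ p ∈ U ∧
    IsCkHolderOn 2 α ρ U ∧ (∀ x ∈ U, (x ∈ Ω ↔ ρ x < 0)) ∧
    (∀ x ∈ U ∩ frontier Ω, fderiv ℝ ρ x ≠ 0) ∧
    ∀ x ∈ U ∩ frontier Ω, ∀ v : E N, v ≠ 0 → fderiv ℝ ρ x v = 0 →
      fderiv ℝ ρ x ((Complex.I : ℂ) • v) = 0 → 0 < levi ρ x v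

instance (N : ℕ) : MeasurableSpace (E N) := borel _

instance (N : ℕ) : BorelSpace (E N) := ⟨rfl⟩

/-- Lebesgue measure on `E N`. -/
def vol (N : ℕ) : Measure (E N) :=
  letI : InnerProductSpace ℝ (E N) := InnerProductSpace.rclikeToReal ℂ (E N)
  letI : MeasureSpace (E N) := measureSpaceOfInnerProductSpace
  volume

/-- Bergman kernel on the diagonal. -/
def bergmanKernelDiag (Ω : Set (E N)) (z : E N) : ℝ :=
  sSup { r : ℝ | ∃ f : E N → ℂ, DifferentiableOn ℂ f Ω ∧
    (∫ x in Ω, ‖f x‖ ^ 2 ∂(vol N)) ≤ 1 ∧ r = ‖f z‖ ^ 2 }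

/-- `M_Ω(z;v)`. -/
def bergmanM (Ω : Set (E N)) (z v : E N) : ℝ :=
  sSup { r : ℝ | ∃ f : E N → ℂ, DifferentiableOn ℂ f Ω ∧
    (∫ x in Ω, ‖f x‖ ^ 2 ∂(vol N)) ≤ 1 ∧ f z = 0 ∧ r = ‖fderiv ℂ f z v‖ }

/-- The Bergman metric. -/
def bergmanMetric (Ω : Set (E N)) (z v : E N) : ℝ :=
  bergmanM Ω z v / Real.sqrt (bergmanKernelDiag Ω z)

/-- The Bergman distance: inner distance of the Bergman metric. -/
def bergmanDist (Ω : Set (E N)) (z w : E N) : ℝ :=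
  sInf { r : ℝ | ∃ γ : ℝ → E N, ContDiffOn ℝ 1 γ (Icc 0 1) ∧ γ 0 = z ∧ γ 1 = w ∧
    (∀ t ∈ Icc (0:ℝ) 1, γ t ∈ Ω) ∧
    r = ∫ t in (0:ℝ)..(1:ℝ), bergmanMetric Ω (γ t) (derivWithin γ (Icc 0 1) t) }

section RealInnerProductSpace

variable {V : Type*} [NormedAddCommGroup V] [InnerProductSpace ℝ V]

/-- The differential at `(p, 0)` of the normal exponential map `(y, t) ↦ (y + t • n y, ρ y)`. -/
def tubularEquiv (l : ℝ) (u : V) (hl : l ≠ 0) (hu : ‖u‖ = 1) : (V × ℝ) ≃L[ℝ] (V × ℝ) :=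
  ContinuousLinearEquiv.equivOfInverse
    ((ContinuousLinearMap.fst ℝ V ℝ + (ContinuousLinearMap.snd ℝ V ℝ).smulRight u).prod
      (l • (innerSL ℝ u).comp (ContinuousLinearMap.fst ℝ V ℝ)))
    ((ContinuousLinearMap.fst ℝ V ℝ -
        ((innerSL ℝ u).comp (ContinuousLinearMap.fst ℝ V ℝ) -
          l⁻¹ • ContinuousLinearMap.snd ℝ V ℝ).smulRight u).prod
      ((innerSL ℝ u).comp (ContinuousLinearMap.fst ℝ V ℝ) -
        l⁻¹ • ContinuousLinearMap.snd ℝ V ℝ))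
    (by
      rintro ⟨v, s⟩
      simp [inner_add_right, inner_smul_right, hu, hl])
    (by
      rintro ⟨w, r⟩
      simp [inner_sub_right, inner_smul_right, hu, hl])

lemma exists_unit_normal [CompleteSpace V] {ρ : V → ℝ} {p : V} (hρ : ContDiffAt ℝ 2 ρ p)
    (h0 : fderiv ℝ ρ p ≠ 0) :
    ∃ (n : V → V) (l : V → ℝ), ContDiffAt ℝ 1 n p ∧
      ∀ᶠ y in 𝓝 p, ‖n y‖ = 1 ∧ 0 < l y ∧ fderiv ℝ ρ y = l y • innerSL ℝ (n y) := by
  set g : V → V := fun y => (InnerProductSpace.toDual ℝ V).symm (fderiv ℝ ρ y) with hg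
  have hd : ContDiffAt ℝ 1 (fderiv ℝ ρ) p := hρ.fderiv_right (by norm_num)
  have hgc : ContDiffAt ℝ 1 g p :=
    ((InnerProductSpace.toDual ℝ V).symm.toContinuousLinearEquiv.contDiff.contDiffAt).comp p hd
  have hgp : g p ≠ 0 := by simpa [hg] using h0
  refine ⟨fun y => ‖g y‖⁻¹ • g y, fun y => ‖g y‖, ?_, ?_⟩
  · exact ((hgc.norm ℝ hgp).inv (norm_ne_zero_iff.2 hgp)).smul hgc
  · filter_upwards [hgc.continuousAt.eventually_ne hgp] with y hy
    have hy' : 0 < ‖g y‖ := norm_pos_iff.2 hy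
    refine ⟨by rw [norm_smul]; simp [hy], hy', ?_⟩
    ext v
    have : inner ℝ (g y) v = fderiv ℝ ρ y v := by
      simp [hg]
    simp [this, hy]

/-- Local coordinates `x = Y x + T x • n (Y x)` around a zero `p` of `ρ`, where `Y x` is a zero of
`ρ`. -/
lemma exists_tubular_coords [CompleteSpace V] {ρ : V → ℝ} {p : V} {n : V → V} {l : V → ℝ}
    (hρ : ContDiffAt ℝ 2 ρ p) (hρp : ρ p = 0) (hn : ContDiffAt ℝ 1 n p)
    (hnl : ∀ᶠ y in 𝓝 p, ‖n y‖ = 1 ∧ 0 < l y ∧ fderiv ℝ ρ y = l y • innerSL ℝ (n y)) :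
    ∃ (Y : V → V) (T : V → ℝ), ContDiffAt ℝ 1 Y p ∧ ContDiffAt ℝ 1 T p ∧ Y p = p ∧ T p = 0 ∧
      (∀ᶠ x in 𝓝 p, ρ (Y x) = 0 ∧ Y x + T x • n (Y x) = x) ∧
      ∀ᶠ q : V × ℝ in 𝓝 (p, 0), ρ q.1 = 0 →
        Y (q.1 + q.2 • n q.1) = q.1 ∧ T (q.1 + q.2 • n q.1) = q.2 := by
  obtain ⟨hn1, hl, hρ'⟩ := hnl.self_of_nhds
  set F : V × ℝ → V × ℝ := fun q => (q.1 + q.2 • n q.1, ρ q.1) with hF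
  have hn' : ContDiffAt ℝ 1 (fun q : V × ℝ => n q.1) (p, 0) := hn.comp (p, (0 : ℝ)) contDiffAt_fst
  have hFc : ContDiffAt ℝ 1 F (p, 0) :=
    (contDiffAt_fst.add (contDiffAt_snd.smul hn')).prodMk
      ((hρ.of_le (by norm_num)).comp (p, (0 : ℝ)) contDiffAt_fst)
  have hFd : HasFDerivAt F (tubularEquiv (l p) (n p) hl.ne' hn1 : V × ℝ →L[ℝ] V × ℝ) (p, 0) := by
    have h1 : HasFDerivAt (fun q : V × ℝ => q.1) (ContinuousLinearMap.fst ℝ V ℝ) (p, 0) :=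
      hasFDerivAt_fst
    have h2 : HasFDerivAt (fun q : V × ℝ => q.2) (ContinuousLinearMap.snd ℝ V ℝ) (p, 0) :=
      hasFDerivAt_snd
    have h3 := (hn'.differentiableAt (by norm_num)).hasFDerivAt
    have h4 : HasFDerivAt ρ (fderiv ℝ ρ p) p := (hρ.differentiableAt (by norm_num)).hasFDerivAt
    have h5 : HasFDerivAt (fun q : V × ℝ => ρ q.1)
        ((fderiv ℝ ρ p).comp (ContinuousLinearMap.fst ℝ V ℝ)) (p, 0) :=
      HasFDerivAt.comp (p, (0 : ℝ)) h4 h1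
    refine ((h1.add (h2.smul h3)).prodMk h5).congr_fderiv ?_
    rw [hρ']
    ext v <;> simp [tubularEquiv]
  have hS : HasStrictFDerivAt F (tubularEquiv (l p) (n p) hl.ne' hn1 : V × ℝ →L[ℝ] V × ℝ) (p, 0) :=
    hFc.hasStrictFDerivAt' hFd (by norm_num)
  have hFp : F (p, 0) = (p, 0) := by simp [hF, hρp]
  set G := hS.localInverse F _ _ with hG
  have hGc : ContDiffAt ℝ 1 G (p, 0) := by
    have := hFc.to_localInverse hFd (by norm_num)
    rwa [hFp] at this
  have hGp : G (p, 0) = (p, 0) := by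
    have := hS.localInverse_apply_image
    rwa [hFp] at this
  have hi : ContDiffAt ℝ 1 (fun x : V => (x, (0 : ℝ))) p := contDiffAt_id.prodMk contDiffAt_const
  have hGi : ContDiffAt ℝ 1 (fun x : V => G (x, 0)) p := ContDiffAt.comp p hGc hi
  refine ⟨fun x => (G (x, 0)).1, fun x => (G (x, 0)).2, hGi.fst, hGi.snd, by simp [hGp],
    by simp [hGp], ?_, ?_⟩
  · have h := hS.eventually_right_inverse
    rw [hFp] at h
    filter_upwards [hi.continuousAt.eventually h] with x hx
    exact ⟨congrArg Prod.snd hx, congrArg Prod.fst hx⟩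
  · filter_upwards [hS.eventually_left_inverse] with q hq hq0
    have : F q = (q.1 + q.2 • n q.1, 0) := by simp [hF, hq0]
    rw [this] at hq
    simp only [hG, hq, and_self]

lemma tubular_coord_hasFDerivAt {ρ : V → ℝ} {p : V} {n : V → V}
    {l : V → ℝ} {Y : V → V} {T : V → ℝ} (hρ : ContDiffAt ℝ 2 ρ p) (hn : ContDiffAt ℝ 1 n p)
    (hnl : ∀ᶠ y in 𝓝 p, ‖n y‖ = 1 ∧ 0 < l y ∧ fderiv ℝ ρ y = l y • innerSL ℝ (n y))
    (hY : ContDiffAt ℝ 1 Y p) (hT : ContDiffAt ℝ 1 T p) (hYp : Y p = p)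
    (hYT : ∀ᶠ x in 𝓝 p, ρ (Y x) = 0 ∧ Y x + T x • n (Y x) = x) :
    ∀ᶠ x in 𝓝 p, HasFDerivAt T (innerSL ℝ (n (Y x))) x := by
  have hYt : Tendsto Y (𝓝 p) (𝓝 p) := by simpa [hYp] using hY.continuousAt.tendsto
  filter_upwards [hYT.eventually_nhds, hY.eventually (by simp), hT.eventually (by simp),
    hYt.eventually (hn.eventually (by simp)),
    hYt.eventually ((hρ.of_le one_le_two).eventually (by simp)),
    hYt.eventually hnl.eventually_nhds] with x hx hYx hTx hnx hρx hnlx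
  obtain ⟨h1, hl, hρ'⟩ := hnlx.self_of_nhds
  have dY := (hYx.differentiableAt (by norm_num)).hasFDerivAt
  have dT := (hTx.differentiableAt (by norm_num)).hasFDerivAt
  have dn := (hnx.differentiableAt (by norm_num)).hasFDerivAt
  have dρ := (hρx.differentiableAt (by norm_num)).hasFDerivAt
  refine dT.congr_fderiv ?_
  ext h
  have e1 : inner ℝ (n (Y x)) (fderiv ℝ Y x h) = 0 := by
    have hc := dρ.comp x dY
    have : HasFDerivAt (ρ ∘ Y) (0 : V →L[ℝ] ℝ) x :=
      (hasFDerivAt_const (0 : ℝ) x).congr_of_eventuallyEq (hx.mono fun y hy => hy.1)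
    have := congrArg (fun L => L h) (hc.unique this)
    simpa [hρ', hl.ne'] using this
  have e2 : inner ℝ (n (Y x)) (fderiv ℝ n (Y x) (fderiv ℝ Y x h)) = 0 := by
    have hc := dn.inner ℝ dn
    have : HasFDerivAt (fun y => inner ℝ (n y) (n y)) (0 : V →L[ℝ] ℝ) (Y x) :=
      (hasFDerivAt_const (1 : ℝ) (Y x)).congr_of_eventuallyEq (hnlx.mono fun y hy => by
        simp only [real_inner_self_eq_norm_sq, hy.1]; norm_num)
    have := congrArg (fun L => L (fderiv ℝ Y x h)) (hc.unique this)
    simpa [real_inner_comm] using this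
  have e3 : fderiv ℝ Y x h + (T x • fderiv ℝ n (Y x) (fderiv ℝ Y x h) +
      fderiv ℝ T x h • n (Y x)) = h := by
    have hc := dY.add (dT.smul (dn.comp x dY))
    have : HasFDerivAt (Y + T • (n ∘ Y)) (ContinuousLinearMap.id ℝ V) x :=
      (hasFDerivAt_id x).congr_of_eventuallyEq (hx.mono fun y hy => hy.2)
    have := congrArg (fun L => L h) (hc.unique this)
    simpa using this
  have := congrArg (fun v => inner ℝ (n (Y x)) v) e3
  simpa [inner_add_right, inner_smul_right, e1, e2, h1] using this

lemma tubular_coord_contDiffAt {p : V} {n Y : V → V} {T : V → ℝ} (hn : ContDiffAt ℝ 1 n p)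
    (hY : ContDiffAt ℝ 1 Y p) (hYp : Y p = p)
    (hT : ∀ᶠ x in 𝓝 p, HasFDerivAt T (innerSL ℝ (n (Y x))) x) : ContDiffAt ℝ 2 T p := by
  have h : ContDiffAt ℝ ((1 : ℕ) + 1) T p := by
    rw [contDiffAt_succ_iff_hasFDerivAt]
    refine ⟨fun x => innerSL ℝ (n (Y x)), ⟨_, hT, fun x hx => hx⟩, ?_⟩
    have : ContDiffAt ℝ 1 (fun x => n (Y x)) p := ContDiffAt.comp p (by rwa [hYp]) hY
    exact (innerSL ℝ (E := V)).contDiff.contDiffAt.comp p this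
  exact_mod_cast h

/-- Moving from a zero `y` of `ρ` along the normal by `t` gives `ρ` the sign of `t`. -/
lemma eventually_pos_mul_of_normal {ρ : V → ℝ} {p : V} {n : V → V} {l : V → ℝ}
    (hρ : ContDiffAt ℝ 2 ρ p) (hn : ContDiffAt ℝ 1 n p)
    (hnl : ∀ᶠ y in 𝓝 p, ‖n y‖ = 1 ∧ 0 < l y ∧ fderiv ℝ ρ y = l y • innerSL ℝ (n y)) :
    ∀ᶠ q : V × ℝ in 𝓝 (p, 0), ρ q.1 = 0 → q.2 ≠ 0 → 0 < q.2 * ρ (q.1 + q.2 • n q.1) := by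
  obtain ⟨hn1, hl, hρ'⟩ := hnl.self_of_nhds
  have hS : HasStrictFDerivAt ρ (fderiv ℝ ρ p) p := hρ.hasStrictFDerivAt (by norm_num)
  have hn' : ContinuousAt (fun q : V × ℝ => n q.1) (p, 0) :=
    ContinuousAt.comp (f := Prod.fst) hn.continuousAt continuousAt_fst
  have ho := hS.isLittleO.def (show 0 < l p / 4 by positivity)
  have hc : Tendsto (fun q : V × ℝ => (q.1 + q.2 • n q.1, q.1)) (𝓝 (p, 0)) (𝓝 (p, p)) := by
    have : ContinuousAt (fun q : V × ℝ => (q.1 + q.2 • n q.1, q.1)) (p, 0) :=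
      (continuousAt_fst.add (continuousAt_snd.smul hn')).prodMk continuousAt_fst
    simpa [ContinuousAt] using this
  have hi : ∀ᶠ q : V × ℝ in 𝓝 (p, 0), 1 / 2 < inner ℝ (n p) (n q.1) := by
    have : ContinuousAt (fun q : V × ℝ => inner ℝ (n p) (n q.1)) (p, 0) :=
      continuousAt_const.inner hn'
    refine this.eventually (lt_mem_nhds ?_)
    simp [hn1]; norm_num
  have hq1 : ∀ᶠ q : V × ℝ in 𝓝 (p, 0), ‖n q.1‖ = 1 :=
    (continuousAt_fst (p := (p, (0 : ℝ)))).eventually (hnl.mono fun y hy => hy.1)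
  filter_upwards [hc.eventually ho, hi, hq1] with q h1 h2 h3 h4 h5
  simp only [h4, sub_zero, add_sub_cancel_left, hρ', map_smul, norm_smul, h3, mul_one,
    _root_.smul_apply, innerSL_apply_apply, smul_eq_mul, Real.norm_eq_abs] at h1
  have h6 : 0 < q.2 ^ 2 := by positivity
  have h7 : |q.2 * (ρ (q.1 + q.2 • n q.1) - q.2 * (l p * inner ℝ (n p) (n q.1)))|
      ≤ l p / 4 * q.2 ^ 2 := by
    rw [abs_mul, ← sq_abs q.2]
    nlinarith [abs_nonneg q.2]
  have h8 := (abs_le.1 h7).1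
  nlinarith [mul_pos h6 hl, mul_lt_mul_of_pos_left h2 (mul_pos h6 hl)]

lemma eventually_mem_frontier_iff {Ω : Set V} (hop : IsOpen Ω) {ρ : V → ℝ} {p : V} {n : V → V}
    {l : V → ℝ} (hΩ : ∀ᶠ x in 𝓝 p, (x ∈ Ω ↔ ρ x < 0))
    (hρ : ContDiffAt ℝ 2 ρ p) (hn : ContDiffAt ℝ 1 n p)
    (hnl : ∀ᶠ y in 𝓝 p, ‖n y‖ = 1 ∧ 0 < l y ∧ fderiv ℝ ρ y = l y • innerSL ℝ (n y)) :
    ∀ᶠ x in 𝓝 p, (x ∈ frontier Ω ↔ ρ x = 0) := by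
  have hs := (eventually_pos_mul_of_normal hρ hn hnl)
  have hs' : ∀ᶠ x in 𝓝 p, ∀ᶠ t in 𝓝 (0 : ℝ),
      ρ x = 0 → t ≠ 0 → 0 < t * ρ (x + t • n x) := by
    rw [nhds_prod_eq] at hs
    exact hs.curry
  filter_upwards [hs', hΩ.eventually_nhds,
    ((hρ.of_le one_le_two).eventually (by simp))] with x h1 h2 h3
  rw [hop.frontier_eq]
  constructor
  · rintro ⟨hx, hx'⟩
    refine le_antisymm ?_ (not_lt.1 fun h => hx' (h2.self_of_nhds.2 h))
    by_contra! h
    obtain ⟨y, hy3, hy1, hy2⟩ := ((mem_closure_iff_frequently.1 hx).and_eventually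
      ((h3.continuousAt.eventually (lt_mem_nhds h)).and h2)).exists
    exact lt_asymm hy1 (hy2.1 hy3)
  · intro hx
    refine ⟨?_, fun h => (h2.self_of_nhds.1 h).ne hx⟩
    have ht : Tendsto (fun t : ℝ => x + t • n x) (𝓝[<] 0) (𝓝 x) := by
      have : ContinuousAt (fun t : ℝ => x + t • n x) 0 := by fun_prop
      have h : Tendsto (fun t : ℝ => x + t • n x) (𝓝 0) (𝓝 x) := by
        simpa [ContinuousAt] using this
      exact h.mono_left nhdsWithin_le_nhds
    refine mem_closure_of_tendsto ht ?_
    filter_upwards [ht.eventually h2, nhdsWithin_le_nhds h1, self_mem_nhdsWithin] with t a1 a2 a3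
    have a3' : t < 0 := a3
    refine a1.2 ?_
    have := a2 hx a3'.ne
    by_contra! h
    nlinarith [mul_nonpos_of_nonpos_of_nonneg a3'.le h]

/-- A closest point `y` of `{ρ = 0}` to `x` satisfies `x - y ∈ ℝ n(y)`. -/
lemma exists_eq_add_smul_normal [CompleteSpace V] {ρ : V → ℝ} {x y u : V} {l : ℝ}
    (hρ : ContDiffAt ℝ 1 ρ y) (hl : 0 < l) (hu : ‖u‖ = 1) (hρ' : fderiv ℝ ρ y = l • innerSL ℝ u)
    (hmin : ∀ᶠ z in 𝓝 y, ρ z = ρ y → dist x y ≤ dist x z) :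
    ∃ t : ℝ, x = y + t • u := by
  have hφ : HasStrictFDerivAt (fun z : V => ‖z - x‖ ^ 2) (2 • innerSL ℝ (y - x)) y := by
    have := (hasStrictFDerivAt_norm_sq (y - x)).comp y ((hasStrictFDerivAt_id y).sub_const x)
    simpa [Function.comp_def] using this
  have hext : IsLocalExtrOn (fun z : V => ‖z - x‖ ^ 2) {z | ρ z = ρ y} y := by
    left
    refine eventually_nhdsWithin_iff.2 (hmin.mono fun z hz hz' => ?_)
    have := hz hz'
    rw [dist_comm x y, dist_comm x z, dist_eq_norm, dist_eq_norm] at this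
    dsimp only
    gcongr
  obtain ⟨a, b, hab, h⟩ := hext.exists_multipliers_of_hasStrictFDerivAt_1d
    (hρ.hasStrictFDerivAt (by norm_num)) hφ
  have hv : (a * l) • u + (2 * b) • (y - x) = 0 := by
    refine ext_inner_right ℝ fun v => ?_
    have := congrArg (fun L => L v) h
    simp [hρ'] at this
    simp [inner_add_left, inner_smul_left, inner_sub_left]
    linarith
  by_cases hb : b = 0
  · have hu0 : u ≠ 0 := by rintro rfl; simp at hu
    have ha : a = 0 := by simpa [hb, hl.ne', hu0] using hv
    simp [ha, hb] at hab
  · refine ⟨a * l / (2 * b), ?_⟩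
    have : (2 * b) • (x - y) = (a * l) • u := by
      rw [← sub_eq_zero, ← neg_sub y x, smul_neg, ← neg_add', neg_eq_zero, add_comm]
      exact hv
    rw [div_eq_inv_mul, ← smul_smul, ← this, smul_smul, inv_mul_cancel₀ (by simpa using hb)]
    simp

/-- Near a `C²` boundary point, the signed distance `d` is `C²`, closest boundary points are
unique, and the gradient of `d` at `x` is the unit normal at the closest point. -/
theorem exists_signed_dist [FiniteDimensional ℝ V] {Ω : Set V} (hop : IsOpen Ω) {ρ : V → ℝ}
    {p : V} (hp : p ∈ frontier Ω) (hΩ : ∀ᶠ x in 𝓝 p, (x ∈ Ω ↔ ρ x < 0))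
    (hρ : ContDiffAt ℝ 2 ρ p) (h0 : fderiv ℝ ρ p ≠ 0) :
    ∃ (Y ν : V → V) (d : V → ℝ), ContDiffAt ℝ 2 d p ∧ Y p = p ∧ d p = 0 ∧
      ∀ᶠ x in 𝓝 p, ‖ν x‖ = 1 ∧ HasFDerivAt d (innerSL ℝ (ν x)) x ∧ ν (Y x) = ν x ∧
        Y x + d x • ν x = x ∧ |d x| = infDist x (frontier Ω) ∧
        (∀ y ∈ frontier Ω, dist x y = infDist x (frontier Ω) → y = Y x) ∧
        (x ∈ Ω ↔ d x < 0) ∧ (x ∈ closure Ω ↔ d x ≤ 0) := by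
  obtain ⟨n, l, hn, hnl⟩ := exists_unit_normal hρ h0
  have hρp : ρ p = 0 := by
    rw [hop.frontier_eq] at hp
    refine le_antisymm ?_ (not_lt.1 fun h => hp.2 (hΩ.self_of_nhds.2 h))
    by_contra! h
    obtain ⟨y, hy3, hy1, hy2⟩ := ((mem_closure_iff_frequently.1 hp.1).and_eventually
      ((hρ.continuousAt.eventually (lt_mem_nhds h)).and hΩ)).exists
    exact lt_asymm hy1 (hy2.1 hy3)
  have hfr := eventually_mem_frontier_iff hop hΩ hρ hn hnl
  obtain ⟨Y, T, hY, hT, hYp, hTp, hYT, hinv⟩ := exists_tubular_coords hρ hρp hn hnl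
  have hTd := tubular_coord_hasFDerivAt hρ hn hnl hY hT hYp hYT
  have hYt : Tendsto Y (𝓝 p) (𝓝 p) := by simpa [hYp] using hY.continuousAt.tendsto
  have hTt : Tendsto T (𝓝 p) (𝓝 0) := by simpa [hTp] using hT.continuousAt.tendsto
  have hYTt : Tendsto (fun x => (Y x, T x)) (𝓝 p) (𝓝 (p, 0)) := by
    rw [nhds_prod_eq]; exact hYt.prodMk hTt
  have hcl : ∀ᶠ x in 𝓝 p, ∀ y ∈ frontier Ω, dist x y = infDist x (frontier Ω) →
      y = Y x ∧ |T x| = dist x y := by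
    have hP : ∀ᶠ y in 𝓝 p, (∀ᶠ z in 𝓝 y, (z ∈ frontier Ω ↔ ρ z = 0)) ∧ ContDiffAt ℝ 1 ρ y ∧
        ‖n y‖ = 1 ∧ 0 < l y ∧ fderiv ℝ ρ y = l y • innerSL ℝ (n y) :=
      hfr.eventually_nhds.and (((hρ.of_le one_le_two).eventually (by simp)).and hnl)
    rw [nhds_prod_eq] at hinv
    obtain ⟨P, hP', Q, hQ', hPQ⟩ := eventually_prod_iff.1 hinv
    obtain ⟨ε, hε, hε'⟩ := Metric.eventually_nhds_iff.1 (hP.and hP')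
    obtain ⟨ε₂, hε₂, hε₂'⟩ := Metric.eventually_nhds_iff.1 hQ'
    filter_upwards [Metric.ball_mem_nhds p (show 0 < min (ε / 2) ε₂ by positivity)]
      with x hx y hy hxy
    have hxp : dist x p < ε / 2 ∧ dist x p < ε₂ := lt_min_iff.1 hx
    have hd : dist x y ≤ dist x p := hxy ▸ infDist_le_dist_of_mem hp
    have hyp : dist y p < ε := by
      have := dist_triangle_left y p x
      linarith [hxp.1]
    obtain ⟨⟨b1, b2, b3, b4, b5⟩, b6⟩ := hε' hyp
    have hρy : ρ y = 0 := b1.self_of_nhds.1 hy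
    obtain ⟨t, ht⟩ := exists_eq_add_smul_normal (x := x) b2 b4 b3 b5 (b1.mono fun z hz hz' => by
      rw [hxy]
      exact infDist_le_dist_of_mem (hz.2 (hz'.trans hρy)))
    have htd : |t| = dist x y := by rw [dist_eq_norm, ht]; simp [norm_smul, b3]
    have := hPQ b6 (hε₂' (y := t) (by rw [Real.dist_eq, sub_zero]; linarith [hxp.2])) hρy
    rw [← ht] at this
    exact ⟨this.1.symm, by rw [this.2, htd]⟩
  have hex : ∀ x, ∃ y ∈ frontier Ω, dist x y = infDist x (frontier Ω) := fun x => by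
    obtain ⟨y, hy, h⟩ := isClosed_frontier.exists_infDist_eq_dist ⟨p, hp⟩ x
    exact ⟨y, hy, h.symm⟩
  refine ⟨Y, fun x => n (Y x), T, tubular_coord_contDiffAt hn hY hYp hTd, hYp, hTp, ?_⟩
  have hinv' : ∀ᶠ y in 𝓝 p, ρ y = 0 → Y y = y := by
    have : Tendsto (fun y : V => (y, (0 : ℝ))) (𝓝 p) (𝓝 (p, 0)) := by
      rw [nhds_prod_eq]; exact tendsto_id.prodMk tendsto_const_nhds
    filter_upwards [this.eventually hinv] with y hy h
    simpa using (hy h).1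
  filter_upwards [hYt.eventually hnl, hTd, hYT, hcl, hYt.eventually hinv',
    hYTt.eventually (eventually_pos_mul_of_normal hρ hn hnl), hΩ, hfr]
    with x h1 h2 h3 h4 h5 h6 h7 h8
  obtain ⟨y, hy, hxy⟩ := hex x
  have h6' := h6 h3.1
  rw [h3.2] at h6'
  have hzero : T x = 0 → ρ x = 0 := fun h => by
    have := h3.2
    rw [h, zero_smul, add_zero] at this
    rw [← this, h3.1]
  have hlt : x ∈ Ω ↔ T x < 0 := by
    rw [h7]
    rcases lt_trichotomy (T x) 0 with h | h | h
    · exact iff_of_true (by by_contra! h'; nlinarith [h6' h.ne]) h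
    · rw [hzero h, h]
    · exact iff_of_false (by nlinarith [h6' h.ne']) h.le.not_gt
  refine ⟨h1.1, h2, by rw [h5 h3.1], h3.2, (h4 y hy hxy).2.trans hxy,
    fun y hy hxy => (h4 y hy hxy).1, hlt, ?_⟩
  rw [closure_eq_self_union_frontier, mem_union, hlt, h8, le_iff_lt_or_eq]
  refine or_congr Iff.rfl ⟨fun h => ?_, hzero⟩
  by_contra h'
  simpa [h] using h6' h'

/-- Second order Taylor expansion, uniform in the base point. -/
lemma eventually_taylor_two {d : V → ℝ} {p : V} (hd : ContDiffAt ℝ 2 d p) {ε : ℝ} (hε : 0 < ε) :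
    ∀ᶠ q : V × V in 𝓝 (p, p),
      |d q.2 - d q.1 - fderiv ℝ d q.1 (q.2 - q.1) -
        1 / 2 * fderiv ℝ (fderiv ℝ d) p (q.2 - q.1) (q.2 - q.1)| ≤ ε * ‖q.2 - q.1‖ ^ 2 := by
  set H := fderiv ℝ (fderiv ℝ d) p
  have hS : HasStrictFDerivAt (fderiv ℝ d) H p :=
    (hd.fderiv_right (m := 1) (by norm_num)).hasStrictFDerivAt (by norm_num)
  have ho := hS.isLittleO.def hε
  have hdiff : ∀ᶠ x in 𝓝 p, DifferentiableAt ℝ d x :=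
    (hd.eventually (by simp)).mono fun x hx => hx.differentiableAt (by norm_num)
  obtain ⟨r₁, hr₁, h₁⟩ := Metric.eventually_nhds_iff_ball.1 ho
  obtain ⟨r₂, hr₂, h₂⟩ := Metric.eventually_nhds_iff_ball.1 hdiff
  have hr : 0 < min r₁ r₂ := lt_min hr₁ hr₂
  filter_upwards [Metric.ball_mem_nhds (p, p) hr] with q hq
  rw [← ball_prod_same] at hq
  obtain ⟨hz, hw⟩ := hq
  set z := q.1
  set k := q.2 - q.1 with hk
  have hseg : ∀ s ∈ Icc (0 : ℝ) 1, z + s • k ∈ ball p (min r₁ r₂) := fun s hs => by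
    have := (convex_ball p (min r₁ r₂)).add_smul_sub_mem hz hw hs
    simpa using this
  have hder : ∀ s ∈ Icc (0 : ℝ) 1, HasDerivWithinAt
      (fun s : ℝ => d (z + s • k) - s * fderiv ℝ d z k - s ^ 2 / 2 * H k k)
      (fderiv ℝ d (z + s • k) k - fderiv ℝ d z k - s * H k k) (Icc 0 1) s := fun s hs => by
    have e1 : HasDerivAt (fun s : ℝ => z + s • k) k s := by
      simpa using ((hasDerivAt_id s).smul_const k).const_add z
    have e2 := (h₂ _ (ball_subset_ball (min_le_right _ _) (hseg s hs))).hasFDerivAt.comp_hasDerivAt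
      s e1
    have e3 := (hasDerivAt_id s).mul_const (fderiv ℝ d z k)
    have e4 := ((hasDerivAt_pow 2 s).div_const 2).mul_const (H k k)
    refine ((e2.sub e3).sub e4).hasDerivWithinAt.congr_deriv ?_
    simp
  have hbd : ∀ s ∈ Ico (0 : ℝ) 1,
      ‖fderiv ℝ d (z + s • k) k - fderiv ℝ d z k - s * H k k‖ ≤ ε * ‖k‖ ^ 2 := fun s hs => by
    have := h₁ (z + s • k, z) (by
      rw [← ball_prod_same]
      exact ⟨ball_subset_ball (min_le_left _ _) (hseg s (Ico_subset_Icc_self hs)),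
        ball_subset_ball (min_le_left _ _) hz⟩)
    simp only [add_sub_cancel_left, map_smul, norm_smul, Real.norm_eq_abs, abs_of_nonneg hs.1]
      at this
    calc ‖fderiv ℝ d (z + s • k) k - fderiv ℝ d z k - s * H k k‖
        = ‖(fderiv ℝ d (z + s • k) - fderiv ℝ d z - s • H k) k‖ := by simp
      _ ≤ ‖fderiv ℝ d (z + s • k) - fderiv ℝ d z - s • H k‖ * ‖k‖ :=
        ContinuousLinearMap.le_opNorm _ _
      _ ≤ ε * (s * ‖k‖) * ‖k‖ := by gcongr
      _ ≤ ε * (1 * ‖k‖) * ‖k‖ := by gcongr; exact hs.2.le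
      _ = ε * ‖k‖ ^ 2 := by ring
  have := norm_image_sub_le_of_norm_deriv_le_segment_01' hder hbd
  have hzk : z + k = q.2 := by simp [z, hk]
  simp only [one_smul, hzk, zero_smul, add_zero, Real.norm_eq_abs] at this
  convert this using 2
  ring

lemma exists_quadratic_lower_bound [FiniteDimensional ℝ V] (B : V →L[ℝ] V →L[ℝ] ℝ) {u : V}
    (hu : ‖u‖ = 1) (hB : ∀ v, v ≠ 0 → inner ℝ u v = 0 → 0 < B v v) :
    ∃ c > 0, ∃ C ≥ 0, ∀ v, c * ‖v‖ ^ 2 - C * |inner ℝ u v| * ‖v‖ ≤ B v v := by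
  have hcont : Continuous fun v => B v v := by fun_prop
  have hK : IsCompact (sphere (0 : V) 1 ∩ {v | inner ℝ u v = 0}) :=
    (isCompact_sphere 0 1).inter_right (isClosed_eq (by fun_prop) continuous_const)
  obtain ⟨c, hc, hcB⟩ : ∃ c > 0, ∀ v ∈ sphere (0 : V) 1 ∩ {v | inner ℝ u v = 0}, c ≤ B v v := by
    rcases (sphere (0 : V) 1 ∩ {v | inner ℝ u v = 0}).eq_empty_or_nonempty with h | h
    · exact ⟨1, one_pos, by simp [h]⟩
    · obtain ⟨v, hv, hmin⟩ := hK.exists_isMinOn h hcont.continuousOn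
      refine ⟨B v v, hB v ?_ hv.2, fun w hw => hmin hw⟩
      rintro rfl
      simp at hv
  have hcB' : ∀ v, inner ℝ u v = 0 → c * ‖v‖ ^ 2 ≤ B v v := fun v hv => by
    by_cases h0 : v = 0
    · simp [h0]
    have hn : ‖v‖ ≠ 0 := norm_ne_zero_iff.2 h0
    have := hcB (‖v‖⁻¹ • v) ⟨by simp [norm_smul, hn], by simp [inner_smul_right, hv]⟩
    simp only [map_smul, _root_.smul_apply, smul_eq_mul] at this
    field_simp at this
    linarith
  refine ⟨c, hc, c + 3 * ‖B‖, by positivity, fun v => ?_⟩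
  set a := inner ℝ u v with ha
  set w := v - a • u with hw
  have huu : inner ℝ u u = (1 : ℝ) := by rw [real_inner_self_eq_norm_sq, hu]; norm_num
  have huw : inner ℝ u w = 0 := by simp [hw, inner_sub_right, inner_smul_right, hu, ← ha]
  have hav : |a| ≤ ‖v‖ := by simpa [hu] using abs_real_inner_le_norm u v
  have hnw : ‖w‖ ^ 2 = ‖v‖ ^ 2 - a ^ 2 := by
    rw [hw, norm_sub_sq_real, inner_smul_right, real_inner_comm, ← ha, norm_smul, hu, mul_one,
      Real.norm_eq_abs, sq_abs]
    ring
  have hwv : ‖w‖ ≤ ‖v‖ := by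
    refine abs_le_of_sq_le_sq' ?_ (norm_nonneg v) |>.2
    nlinarith [sq_nonneg a]
  have hvw : v = w + a • u := by simp [hw]
  have hexp : B v v = B w w + a * (B w u + B u v) := by
    conv_lhs => rw [hvw]
    rw [hw]
    simp
    ring
  have hB1 : |B w u| ≤ ‖B‖ * ‖v‖ := by
    have := B.le_opNorm₂ w u
    rw [hu, mul_one] at this
    exact this.trans (by gcongr)
  have hB2 : |B u v| ≤ ‖B‖ * ‖v‖ := by
    have := B.le_opNorm₂ u v
    rwa [hu, mul_one] at this
  have hB3 : |a * (B w u + B u v)| ≤ |a| * (2 * (‖B‖ * ‖v‖)) := by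
    rw [abs_mul]
    gcongr
    exact (abs_add_le _ _).trans (by linarith)
  have h5 := (abs_le.1 hB3).1
  have h6 := hcB' w huw
  rw [hnw] at h6
  have h7 : a ^ 2 ≤ |a| * ‖v‖ := by
    rw [← sq_abs, sq]; gcongr
  have h8 : 0 ≤ ‖B‖ * (|a| * ‖v‖) := by positivity
  nlinarith [mul_le_mul_of_nonneg_left h7 hc.le]

/-- If the Hessian of `d` is positive on the kernel of `d' p`, then `d` is locally strongly convex
up to a multiple of the first order term. -/
lemma eventually_strong_convexity_estimate [FiniteDimensional ℝ V] {d : V → ℝ} {p u : V}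
    (hd : ContDiffAt ℝ 2 d p) (hu : ‖u‖ = 1) (hdp : fderiv ℝ d p = innerSL ℝ u)
    (hH : ∀ v, v ≠ 0 → inner ℝ u v = 0 → 0 < fderiv ℝ (fderiv ℝ d) p v v) :
    ∃ c > 0, ∀ᶠ q : V × V in 𝓝 (p, p),
      c * ‖q.2 - q.1‖ ^ 2 ≤ d q.2 - d q.1 + 2 * |fderiv ℝ d q.1 (q.2 - q.1)| := by
  obtain ⟨c, hc, C, hC, hB⟩ := exists_quadratic_lower_bound _ hu hH
  set H := fderiv ℝ (fderiv ℝ d) p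
  refine ⟨c / 8, by positivity, ?_⟩
  have h1 := eventually_taylor_two hd (show 0 < c / 8 by positivity)
  have hcd : ContinuousAt (fderiv ℝ d) p :=
    (hd.fderiv_right (m := 1) (by norm_num)).continuousAt
  have h2 : ∀ᶠ q : V × V in 𝓝 (p, p), C * ‖innerSL ℝ u - fderiv ℝ d q.1‖ < c / 4 := by
    have : ContinuousAt (fun q : V × V => C * ‖innerSL ℝ u - fderiv ℝ d q.1‖) (p, p) :=
      (continuousAt_const.sub (ContinuousAt.comp (f := Prod.fst) hcd continuousAt_fst)).norm.const_mul C
    refine this.eventually (gt_mem_nhds ?_)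
    simp [hdp, hc]
  have h3 : ∀ᶠ q : V × V in 𝓝 (p, p), C * ‖q.2 - q.1‖ < 2 := by
    have : ContinuousAt (fun q : V × V => C * ‖q.2 - q.1‖) (p, p) := by fun_prop
    refine this.eventually (gt_mem_nhds ?_)
    simp
  filter_upwards [h1, h2, h3] with q h1 h2 h3
  set k := q.2 - q.1
  set A := fderiv ℝ d q.1
  have h4 : |inner ℝ u k| ≤ |A k| + ‖innerSL ℝ u - A‖ * ‖k‖ := by
    have := (innerSL ℝ u - A).le_opNorm k
    simp only [_root_.sub_apply, innerSL_apply_apply, Real.norm_eq_abs] at this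
    have h := abs_add_le (A k) (inner ℝ u k - A k)
    rw [add_sub_cancel] at h
    linarith
  have h5 : C * |inner ℝ u k| * ‖k‖ ≤ 2 * |A k| + c / 4 * ‖k‖ ^ 2 := by
    calc C * |inner ℝ u k| * ‖k‖ ≤ C * (|A k| + ‖innerSL ℝ u - A‖ * ‖k‖) * ‖k‖ := by gcongr
      _ = (C * ‖k‖) * |A k| + C * ‖innerSL ℝ u - A‖ * ‖k‖ ^ 2 := by ring
      _ ≤ _ := by gcongr
  have h6 := hB k
  have h7 := (abs_le.1 h1).1
  have h8 := neg_abs_le (A k)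
  nlinarith [sq_nonneg ‖k‖]

/-- Parabolic arcs tangent to the boundary with large enough curvature enter `{d < 0}`. -/
lemma eventually_parabola_neg {d : V → ℝ} {p u v : V} {a : ℝ}
    (hd : ContDiffAt ℝ 2 d p) (hu : ‖u‖ = 1) (hd0 : d p = 0) (hdp : fderiv ℝ d p = innerSL ℝ u)
    (huv : inner ℝ u v = 0) (ha : 1 / 2 * fderiv ℝ (fderiv ℝ d) p v v < a) :
    ∀ᶠ s in 𝓝[>] (0 : ℝ), d (p + (s • v - (a * s ^ 2) • u)) < 0 := by
  set H := fderiv ℝ (fderiv ℝ d) p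
  set m : ℝ → V := fun s => v - (a * s) • u with hm
  have hmc : Continuous m := by fun_prop
  have hm0 : m 0 = v := by simp [hm]
  obtain ⟨ε, hε, hε'⟩ : ∃ ε > 0, 1 / 2 * H v v + ε * ‖v‖ ^ 2 < a := by
    have : ContinuousAt (fun ε : ℝ => 1 / 2 * H v v + ε * ‖v‖ ^ 2) 0 := by fun_prop
    have h := this.eventually (gt_mem_nhds (show 1 / 2 * H v v + 0 * ‖v‖ ^ 2 < a by simpa using ha))
    obtain ⟨ε, h1, h2⟩ := ((h.filter_mono nhdsWithin_le_nhds).and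
      (self_mem_nhdsWithin : Ioi (0 : ℝ) ∈ 𝓝[>] 0)).exists
    exact ⟨ε, h2, h1⟩
  have hm1 : ∀ᶠ s in 𝓝 (0 : ℝ), 1 / 2 * H (m s) (m s) + ε * ‖m s‖ ^ 2 < a := by
    have : Continuous (fun s => 1 / 2 * H (m s) (m s) + ε * ‖m s‖ ^ 2) := by fun_prop
    exact this.continuousAt.eventually (gt_mem_nhds (by simpa [hm0] using hε'))
  have ht : Tendsto (fun s : ℝ => (p, p + s • m s)) (𝓝 0) (𝓝 (p, p)) := by
    have : Continuous (fun s : ℝ => (p, p + s • m s)) := by fun_prop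
    simpa using this.tendsto 0
  filter_upwards [nhdsWithin_le_nhds hm1, nhdsWithin_le_nhds (ht.eventually
    (eventually_taylor_two hd hε)), self_mem_nhdsWithin] with s h1 h2 h3
  have hs : 0 < s := h3
  have e : s • v - (a * s ^ 2) • u = s • m s := by
    simp only [hm, smul_sub, smul_smul]; congr 2; ring
  rw [e]
  have e2 : inner ℝ u (m s) = - (a * s) := by
    simp [hm, inner_sub_right, inner_smul_right, huv, hu]
  simp only [add_sub_cancel_left, hd0, hdp, map_smul, innerSL_apply_apply, e2, smul_eq_mul,
    norm_smul, _root_.smul_apply, Real.norm_eq_abs, sub_zero, mul_pow, sq_abs] at h2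
  have := (abs_le.1 h2).2
  nlinarith [mul_lt_mul_of_pos_left h1 (sq_pos_of_pos hs)]

end RealInnerProductSpace

lemma pos_liminf_iff {α : Type*} {F : Filter α} {u : α → ℝ} (hu : ∀ x, 0 ≤ u x) {C : ℝ}
    (hC : ∃ᶠ x in F, u x ≤ C) : 0 < liminf u F ↔ ∃ c > 0, ∀ᶠ x in F, c ≤ u x := by
  constructor
  · intro h
    obtain ⟨c, hc, hc'⟩ := exists_between h
    exact ⟨c, hc, (eventually_lt_of_lt_liminf hc'
      (isBoundedUnder_of ⟨0, fun x => hu x⟩)).mono fun x hx => hx.le⟩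
  · rintro ⟨c, hc, h⟩
    exact hc.trans_le (le_liminf_of_le (IsCoboundedUnder.of_frequently_le hC) h)

lemma herm_re (a b : E N) : (herm a b).re = inner ℝ b a := by
  simp [herm, PiLp.inner_apply, Complex.inner]

lemma hfunR_nonneg (Ω : Set (E N)) (π : E N → E N) (z w : E N) : 0 ≤ hfunR Ω π z w := by
  have : 0 ≤ bdist Ω z := infDist_nonneg
  unfold hfunR ncompR
  positivity

/-- The signed distance near a `C²` boundary point and its relation to closest boundary points. -/
lemma exists_local_signedDist {Ω : Set (E N)} (hop : IsOpen Ω) {p η : E N}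
    (hp : IsCkBoundaryPoint 2 Ω p) (hη : IsOuterUnitNormalAt Ω p η) :
    ∃ d : E N → ℝ, ContDiffAt ℝ 2 d p ∧ d p = 0 ∧ fderiv ℝ d p = innerSL ℝ η ∧
      signedDist Ω =ᶠ[𝓝 p] d ∧ ∀ᶠ x in 𝓝 p, (x ∈ Ω ↔ d x < 0) ∧ |d x| = bdist Ω x ∧
        ∃ y₀, ∀ y ∈ frontier Ω, dist x y = bdist Ω x →
          y = y₀ ∧ ∀ v, inner ℝ (y - x) v = -d x * fderiv ℝ d x v := by
  obtain ⟨hpf, U, ρ, hU, hpU, hρ, hΩ, h0⟩ := hp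
  obtain ⟨hη1, -, ε, hε, hηt⟩ := hη
  have hUn : U ∈ 𝓝 p := hU.mem_nhds hpU
  obtain ⟨Y, ν, d, hd, hYp, hdp, hx⟩ := exists_signed_dist hop hpf (ρ := ρ)
    (eventually_of_mem hUn hΩ) (hρ.contDiffAt hUn) (h0 p ⟨hpU, hpf⟩)
  have hν : ν p = η := by
    have ht : Tendsto (fun t : ℝ => p - t • η) (𝓝[>] 0) (𝓝 p) := by
      have : Continuous (fun t : ℝ => p - t • η) := by fun_prop
      exact (by simpa using this.tendsto 0 : Tendsto _ _ (𝓝 p)).mono_left nhdsWithin_le_nhds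
    obtain ⟨t, ⟨-, -, h3, h4, h5, h6, h7, -⟩, ht0, htε⟩ :=
      ((ht.eventually hx).and (Ioo_mem_nhdsGT hε)).exists
    obtain ⟨hm, hb⟩ := hηt t ht0 htε
    unfold bdist at hb
    have hY : p = Y (p - t • η) := h6 p hpf (by
      rw [hb, dist_eq_norm]; simp [norm_smul, hη1, ht0.le])
    have hdt : d (p - t • η) = -t := by
      rw [hb, abs_of_neg (h7.1 hm)] at h5
      linarith
    rw [← hY] at h3
    rw [← hY, hdt, neg_smul, ← sub_eq_add_neg, sub_right_inj] at h4
    rw [h3]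
    exact smul_right_injective _ ht0.ne' h4
  refine ⟨d, hd, hdp, ?_, ?_, ?_⟩
  · rw [hx.self_of_nhds.2.1.fderiv, hν]
  · filter_upwards [hx] with x ⟨_, _, _, _, h5, _, _, h8⟩
    unfold signedDist bdist
    split_ifs with h
    · rw [← h5, abs_of_nonpos (h8.1 h), neg_neg]
    · rw [← h5, abs_of_pos (not_le.1 fun h' => h (h8.2 h'))]
  · filter_upwards [hx] with x ⟨_, h2, _, h4, h5, h6, h7, _⟩
    refine ⟨h7, h5, Y x, fun y hy hxy => ⟨h6 y hy hxy, fun v => ?_⟩⟩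
    have : y - x = (-d x) • ν x := by
      rw [h6 y hy hxy, neg_smul, ← sub_eq_zero]
      nth_rw 2 [← h4]
      abel
    rw [this, h2.fderiv, inner_smul_left]
    simp

lemma hessSD_eq {Ω : Set (E N)} {p : E N} {d : E N → ℝ} (h : signedDist Ω =ᶠ[𝓝 p] d) (v : E N) :
    hessSD Ω p v = fderiv ℝ (fderiv ℝ d) p v v := by
  rw [hessSD, iteratedFDeriv_two_apply, h.fderiv.fderiv_eq]
  simp

/-- Strong convexity bounds `h^ℝ` from below by the squared distance. -/
lemma StronglyConvexAt.exists_le_hfunR {Ω : Set (E N)} (hop : IsOpen Ω) {p η : E N}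
    (hp : IsCkBoundaryPoint 2 Ω p) (hη : IsOuterUnitNormalAt Ω p η) {π : E N → E N}
    (hπ : IsClosestPointSelection Ω π) (h : StronglyConvexAt Ω p η) :
    ∃ c > 0, ∀ᶠ q : E N × E N in ((𝓝[Ω] p) ×ˢ (𝓝[Ω] p)) ⊓ 𝓟 {q : E N × E N | q.1 ≠ q.2},
      c ≤ hfunR Ω π q.1 q.2 / ‖q.1 - q.2‖ ^ 2 := by
  obtain ⟨d, hd, -, hdp, hsd, hx⟩ := exists_local_signedDist hop hp hη
  obtain ⟨c, hc, hest⟩ := eventually_strong_convexity_estimate hd hη.1 hdp fun v hv hv' => by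
    rw [← hessSD_eq hsd]
    exact h v hv (by rw [herm_re, hv'])
  refine ⟨min (c / 4) (√(c / 2)), by positivity, ?_⟩
  rw [eventually_inf_principal]
  have hle : (𝓝[Ω] p) ×ˢ (𝓝[Ω] p) ≤ 𝓝 (p, p) := by
    rw [nhds_prod_eq]
    exact Filter.prod_mono nhdsWithin_le_nhds nhdsWithin_le_nhds
  have hx' : ∀ᶠ x in 𝓝[Ω] p, _ := (hx.filter_mono nhdsWithin_le_nhds).and self_mem_nhdsWithin
  filter_upwards [hest.filter_mono hle, hx'.prod_mk hx'] with ⟨z, w⟩ h1 h2 hne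
  obtain ⟨⟨⟨hz, hdz, y₀, hy₀⟩, hzΩ⟩, ⟨⟨hw, -⟩, hwΩ⟩⟩ := h2
  dsimp only at h1 hz hdz hzΩ hw hwΩ hy₀ ⊢
  have hdz0 := hz.1 hzΩ
  have hdw0 := hw.1 hwΩ
  rw [abs_of_neg hdz0] at hdz
  have hk : 0 < ‖z - w‖ := norm_pos_iff.2 (sub_ne_zero.2 hne)
  have hδ : 0 < bdist Ω z := by linarith
  have hnc : ncompR Ω π z (z - w) = |fderiv ℝ d z (w - z)| := by
    have := (hy₀ _ (hπ z hzΩ).1 (hπ z hzΩ).2).2 (z - w)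
    rw [ncompR, herm_re, this, hdz, abs_mul, abs_of_pos hδ, mul_div_cancel_left₀ _ hδ.ne',
      ← neg_sub w z, map_neg, abs_neg]
  rw [le_div_iff₀ (by positivity), hfunR, hnc]
  rw [norm_sub_rev w z] at h1
  set A := |fderiv ℝ d z (w - z)|
  have hA : 0 ≤ A := abs_nonneg _
  rcases le_or_gt (bdist Ω z) (c / 2 * ‖z - w‖ ^ 2) with hb | hb
  · calc min (c / 4) (√(c / 2)) * ‖z - w‖ ^ 2 ≤ c / 4 * ‖z - w‖ ^ 2 := by
          gcongr; exact min_le_left _ _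
      _ ≤ A := by linarith
      _ ≤ A + ‖z - w‖ * √(bdist Ω z) := by
          have : 0 ≤ ‖z - w‖ * √(bdist Ω z) := by positivity
          linarith
  · calc min (c / 4) (√(c / 2)) * ‖z - w‖ ^ 2 ≤ √(c / 2) * ‖z - w‖ ^ 2 := by
          gcongr; exact min_le_right _ _
      _ = ‖z - w‖ * √(c / 2 * ‖z - w‖ ^ 2) := by
          rw [Real.sqrt_mul (by positivity), Real.sqrt_sq hk.le]; ring
      _ ≤ ‖z - w‖ * √(bdist Ω z) := by gcongr
      _ ≤ A + ‖z - w‖ * √(bdist Ω z) := by linarith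

/-- Letting `z` tend to `p` along the normal, a lower bound for `h^ℝ(z, w)` yields one for the
normal component of `p - w`. -/
lemma eventually_le_normal_of_le_hfunR {Ω : Set (E N)} (hop : IsOpen Ω) {p η : E N}
    (hp : IsCkBoundaryPoint 2 Ω p) (hη : IsOuterUnitNormalAt Ω p η) {π : E N → E N}
    (hπ : IsClosestPointSelection Ω π) {c : ℝ}
    (h : ∀ᶠ q : E N × E N in ((𝓝[Ω] p) ×ˢ (𝓝[Ω] p)) ⊓ 𝓟 {q : E N × E N | q.1 ≠ q.2},
      c ≤ hfunR Ω π q.1 q.2 / ‖q.1 - q.2‖ ^ 2) :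
    ∀ᶠ w in 𝓝[Ω] p, c ≤ |(herm (p - w) η).re| / ‖p - w‖ ^ 2 := by
  obtain ⟨d, -, -, -, -, hx⟩ := exists_local_signedDist hop hp hη
  obtain ⟨hη1, hpf, ε, hε, hηt⟩ := hη
  have ht : Tendsto (fun t : ℝ => p - t • η) (𝓝 0) (𝓝 p) := by
    have : Continuous (fun t : ℝ => p - t • η) := by fun_prop
    simpa using this.tendsto 0
  have ht' : Tendsto (fun t : ℝ => p - t • η) (𝓝[>] 0) (𝓝 p) := ht.mono_left nhdsWithin_le_nhds
  have htΩ : Tendsto (fun t : ℝ => p - t • η) (𝓝[>] 0) (𝓝[Ω] p) := by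
    refine tendsto_nhdsWithin_iff.2 ⟨ht', ?_⟩
    filter_upwards [Ioo_mem_nhdsGT hε] with t h using (hηt t h.1 h.2).1
  rw [eventually_inf_principal, eventually_swap_iff] at h
  filter_upwards [h.curry, self_mem_nhdsWithin] with w hw hwΩ
  have hwp : w ≠ p := by
    rintro rfl
    rw [hop.frontier_eq] at hpf
    exact hpf.2 hwΩ
  have hlim : Tendsto (fun t : ℝ => (|inner ℝ η (p - t • η - w)| + ‖p - t • η - w‖ * √t) /
      ‖p - t • η - w‖ ^ 2) (𝓝[>] 0) (𝓝 (|(herm (p - w) η).re| / ‖p - w‖ ^ 2)) := by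
    have hn : ‖p - w‖ ^ 2 ≠ 0 := pow_ne_zero _ (norm_ne_zero_iff.2 (sub_ne_zero.2 hwp.symm))
    have : ContinuousAt (fun t : ℝ => (|inner ℝ η (p - t • η - w)| + ‖p - t • η - w‖ * √t) /
        ‖p - t • η - w‖ ^ 2) 0 := by
      refine ContinuousAt.div (by fun_prop) (by fun_prop) (by simpa using hn)
    have h2 := this.tendsto.mono_left (nhdsWithin_le_nhds (s := Ioi (0 : ℝ)))
    simpa [herm_re] using h2
  refine ge_of_tendsto hlim ?_
  filter_upwards [htΩ.eventually hw, ht'.eventually hx, ht'.eventually_ne hwp.symm,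
    Ioo_mem_nhdsGT hε] with t h1 h2 h3 h4
  refine (h1 h3).trans_eq ?_
  obtain ⟨hm, hb⟩ := hηt t h4.1 h4.2
  obtain ⟨-, -, y₀, hy₀⟩ := h2
  have hπp : π (p - t • η) = p := by
    rw [(hy₀ _ (hπ _ hm).1 (hπ _ hm).2).1]
    refine (hy₀ p hpf ?_).1.symm
    rw [hb, dist_eq_norm]
    simp [norm_smul, hη1, h4.1.le]
  have ht0 : 0 < t := h4.1
  simp only [Prod.swap]
  rw [hfunR, ncompR, herm_re, hπp, hb, sub_sub_cancel, inner_smul_left, abs_mul]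
  simp [abs_of_pos ht0, ht0.ne']

/-- Boundary points tangent to `v` are approached with normal component governed by the Hessian. -/
lemma frequently_normal_le {Ω : Set (E N)} (hop : IsOpen Ω) {p η v : E N}
    (hp : IsCkBoundaryPoint 2 Ω p) (hη : IsOuterUnitNormalAt Ω p η) (hv : v ≠ 0)
    (hηv : (herm v η).re = 0) {a : ℝ} (ha : 1 / 2 * hessSD Ω p v < a) :
    ∃ᶠ w in 𝓝[Ω] p, |(herm (p - w) η).re| / ‖p - w‖ ^ 2 ≤ |a| / ‖v‖ ^ 2 := by
  obtain ⟨d, hd, hd0, hdp, hsd, hx⟩ := exists_local_signedDist hop hp hη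
  rw [hessSD_eq hsd] at ha
  rw [herm_re] at hηv
  have hη1 := hη.1
  have hneg := eventually_parabola_neg hd hη.1 hd0 hdp hηv ha
  have ht : Tendsto (fun s : ℝ => p + (s • v - (a * s ^ 2) • η)) (𝓝[>] 0) (𝓝 p) := by
    have : Continuous (fun s : ℝ => p + (s • v - (a * s ^ 2) • η)) := by fun_prop
    exact (by simpa using this.tendsto 0 : Tendsto _ _ (𝓝 p)).mono_left nhdsWithin_le_nhds
  have htΩ : Tendsto (fun s : ℝ => p + (s • v - (a * s ^ 2) • η)) (𝓝[>] 0) (𝓝[Ω] p) := by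
    refine tendsto_nhdsWithin_iff.2 ⟨ht, ?_⟩
    filter_upwards [hneg, ht.eventually hx] with s h1 h2 using h2.1.2 h1
  refine htΩ.frequently (Eventually.frequently ?_)
  filter_upwards [self_mem_nhdsWithin] with s hs
  have hs0 : 0 < s := hs
  have hv0 : 0 < ‖v‖ := norm_pos_iff.2 hv
  have h1 : |inner ℝ η (p - (p + (s • v - (a * s ^ 2) • η)))| = |a| * s ^ 2 := by
    simp [inner_sub_right, inner_smul_right, hηv, hη1, abs_mul]
  have h2 : s ^ 2 * ‖v‖ ^ 2 ≤ ‖p - (p + (s • v - (a * s ^ 2) • η))‖ ^ 2 := by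
    rw [sub_add_cancel_left, norm_neg, norm_sub_sq_real, inner_smul_left, inner_smul_right,
      real_inner_comm, hηv, norm_smul, Real.norm_eq_abs, mul_pow, sq_abs]
    simp
  rw [herm_re, h1]
  calc |a| * s ^ 2 / ‖p - (p + (s • v - (a * s ^ 2) • η))‖ ^ 2
      ≤ |a| * s ^ 2 / (s ^ 2 * ‖v‖ ^ 2) := by gcongr
    _ = |a| / ‖v‖ ^ 2 := by field_simp

lemma exists_frequently_normal_le {Ω : Set (E N)} (hop : IsOpen Ω) {p η : E N}
    (hp : IsCkBoundaryPoint 2 Ω p) (hη : IsOuterUnitNormalAt Ω p η) :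
    ∃ C, ∃ᶠ w in 𝓝[Ω] p, |(herm (p - w) η).re| / ‖p - w‖ ^ 2 ≤ C := by
  have hη0 : η ≠ 0 := by
    rintro rfl
    simpa using hη.1
  refine ⟨_, frequently_normal_le hop hp hη (v := Complex.I • η)
    (smul_ne_zero Complex.I_ne_zero hη0) ?_ (lt_add_one _)⟩
  simp [herm, mul_assoc, Complex.mul_conj]

lemma stronglyConvexAt_of_le_normal {Ω : Set (E N)} (hop : IsOpen Ω) {p η : E N}
    (hp : IsCkBoundaryPoint 2 Ω p) (hη : IsOuterUnitNormalAt Ω p η) {c : ℝ} (hc : 0 < c)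
    (h : ∀ᶠ w in 𝓝[Ω] p, c ≤ |(herm (p - w) η).re| / ‖p - w‖ ^ 2) :
    StronglyConvexAt Ω p η := by
  intro v hv hηv
  by_contra! hH
  have hv0 : 0 < ‖v‖ := norm_pos_iff.2 hv
  have hpos : 0 < c * ‖v‖ ^ 2 / 2 := by positivity
  obtain ⟨w, h1, h2⟩ := ((frequently_normal_le hop hp hη hv hηv
    (a := c * ‖v‖ ^ 2 / 2) (by linarith)).and_eventually h).exists
  rw [abs_of_pos hpos] at h1
  have : c * ‖v‖ ^ 2 / 2 / ‖v‖ ^ 2 = c / 2 := by field_simp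
  linarith

/-- Real analogue: characterizations of strong convexity at a
`C²`-smooth boundary point. -/
theorem stmt19 {N : ℕ} (Ω : Set (E N)) (hop : IsOpen Ω) (hconn : IsConnected Ω)
    (p η : E N) (hp : IsCkBoundaryPoint 2 Ω p) (hη : IsOuterUnitNormalAt Ω p η)
    (π : E N → E N) (hπ : IsClosestPointSelection Ω π) :
    (StronglyConvexAt Ω p η ↔
      0 < Filter.liminf (fun q : E N × E N => hfunR Ω π q.1 q.2 / ‖q.1 - q.2‖ ^ 2)
        (((𝓝[Ω] p) ×ˢ (𝓝[Ω] p)) ⊓ 𝓟 {q : E N × E N | q.1 ≠ q.2})) ∧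
    ((0 < Filter.liminf (fun q : E N × E N => hfunR Ω π q.1 q.2 / ‖q.1 - q.2‖ ^ 2)
        (((𝓝[Ω] p) ×ˢ (𝓝[Ω] p)) ⊓ 𝓟 {q : E N × E N | q.1 ≠ q.2})) ↔
      0 < Filter.liminf (fun w : E N => |(herm (p - w) η).re| / ‖p - w‖ ^ 2) (𝓝[Ω] p)) := by
  obtain ⟨C, hC⟩ := exists_frequently_normal_le hop hp hη
  have hC' : ∃ᶠ q : E N × E N in ((𝓝[Ω] p) ×ˢ (𝓝[Ω] p)) ⊓ 𝓟 {q : E N × E N | q.1 ≠ q.2},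
      hfunR Ω π q.1 q.2 / ‖q.1 - q.2‖ ^ 2 ≤ C + 1 := by
    intro h
    obtain ⟨w, h1, h2⟩ := (hC.and_eventually (eventually_le_normal_of_le_hfunR hop hp hη hπ
      (c := C + 1) (h.mono fun q hq => (not_le.1 hq).le))).exists
    linarith
  have e2 := pos_liminf_iff
    (fun q : E N × E N => div_nonneg (hfunR_nonneg Ω π q.1 q.2) (sq_nonneg ‖q.1 - q.2‖)) hC'
  have e3 := pos_liminf_iff
    (fun w : E N => div_nonneg (abs_nonneg (herm (p - w) η).re) (sq_nonneg ‖p - w‖)) hC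
  have h12 := fun h => e2.2 (StronglyConvexAt.exists_le_hfunR hop hp hη hπ h)
  have h23 := fun h => e3.2 ((e2.1 h).imp fun c hc =>
    ⟨hc.1, eventually_le_normal_of_le_hfunR hop hp hη hπ hc.2⟩)
  have h31 : _ → StronglyConvexAt Ω p η := fun h =>
    (e3.1 h).elim fun c hc => stronglyConvexAt_of_le_normal hop hp hη hc.1 hc.2
  exact ⟨⟨h12, fun h => h31 (h23 h)⟩, h23, fun h => h12 (h31 h)⟩

end InvDist
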